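/- Let 1 ≤ k ≤ n. The Gårding cone Γ_k = {λ ∈ ℝⁿ : σ_j(λ) > 0 for j = 1,…,k} is an open convex cone in ℝⁿ: it is open, convex, and closed under multiplication by positive scalars; moreover the positive orthant {λ : λ_i > 0 for all i} is contained in Γ_k. -/

import Mathlib

/-- The `m`-th elementary symmetric polynomial of `λ ∈ ℝⁿ`. -/
noncomputable def esymm (n m : ℕ) (lam : Fin n → ℝ) : ℝ :=
  ∑ s ∈ Finset.powersetCard m (Finset.univ : Finset (Fin n)), ∏ i ∈ s, lam i

/-- The Gårding cone `Γ_k`. -/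
def GardingCone (n k : ℕ) : Set (Fin n → ℝ) :=
  {lam | ∀ j, 1 ≤ j → j ≤ k → 0 < esymm n j lam}

/-- The quadratic-over-linear function `x ^ 2 / r` is subadditive on `r > 0`. -/
lemma add_sq_div_add_le (x y : ℝ) {r s : ℝ} (hr : 0 < r) (hs : 0 < s) :
    (x + y) ^ 2 / (r + s) ≤ x ^ 2 / r + y ^ 2 / s := by
  rw [div_add_div _ _ hr.ne' hs.ne', div_le_div_iff₀ (by positivity) (by positivity)]
  nlinarith [sq_nonneg (x * s - y * r)]

open Polynomial in
/-- The Laguerre inequality for real-rooted polynomials. -/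
lemma laguerre_inequality {p : ℝ[X]} (hp : p.Splits) (x : ℝ) :
    p.eval x * (derivative (derivative p)).eval x ≤ (derivative p).eval x ^ 2 := by
  have key : ∀ m : Multiset ℝ, ∀ a : ℝ, ∀ q : ℝ[X],
      q = C a * (m.map fun r => X - C r).prod →
      q.eval x * (derivative (derivative q)).eval x ≤ (derivative q).eval x ^ 2 := by
    intro m
    induction m using Multiset.induction with
    | empty => rintro a q rfl; simp
    | cons r m ih =>
      intro a q hq
      obtain ⟨g, hg⟩ : ∃ g : ℝ[X], g = C a * (m.map fun r => X - C r).prod := ⟨_, rfl⟩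
      have hqg : q = (X - C r) * g := by
        rw [hq, hg, Multiset.map_cons, Multiset.prod_cons]; ring
      have h := ih a g hg
      rw [hqg]
      simp only [derivative_mul, derivative_sub, derivative_X, derivative_C, derivative_add,
        eval_mul, eval_add, eval_sub, eval_X, eval_C, sub_zero, one_mul]
      nlinarith [mul_nonneg (sq_nonneg (x - r)) (sub_nonneg.2 h), sq_nonneg (g.eval x)]
  exact key p.roots p.leadingCoeff p hp.eq_prod_roots

open Polynomial in
lemma splits_derivative_of_real {p : ℝ[X]} (hp : p.Splits) : (derivative p).Splits := by
  by_cases hd : derivative p = 0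
  · rw [hd]; exact Splits.zero
  have hpos : p.natDegree ≠ 0 := fun h => hd (derivative_of_natDegree_zero h)
  rw [splits_iff_card_roots]
  apply le_antisymm (card_roots' _)
  have h1 := card_roots_le_derivative p
  rw [splits_iff_card_roots.1 hp] at h1
  have h2 := natDegree_derivative_lt hpos
  lia

open Polynomial in
/-- A weak form of Newton's inequalities for real-rooted polynomials. -/
lemma coeff_mul_coeff_le_sq {p : ℝ[X]} (hp : p.Splits) (m : ℕ) :
    p.coeff m * p.coeff (m + 2) ≤ p.coeff (m + 1) ^ 2 := by
  have hs : ∀ m : ℕ, (derivative^[m] p).Splits := by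
    intro m
    induction m with
    | zero => exact hp
    | succ m ih =>
      rw [Function.iterate_succ_apply']
      exact splits_derivative_of_real ih
  have h := laguerre_inequality (hs m) 0
  rw [← Function.iterate_succ_apply' derivative, ← Function.iterate_succ_apply' derivative] at h
  simp only [← coeff_zero_eq_eval_zero, coeff_iterate_derivative, zero_add,
    Nat.descFactorial_self, nsmul_eq_mul, Nat.succ_eq_add_one, Nat.factorial_succ] at h
  push_cast at h
  have hf : (0 : ℝ) < (m.factorial : ℝ) ^ 2 * (m + 1) := by positivity
  have h' : (m + 2 : ℝ) * (p.coeff m * p.coeff (m + 2)) ≤ (m + 1) * p.coeff (m + 1) ^ 2 := by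
    apply le_of_mul_le_mul_left _ hf
    linarith
  by_contra! hc
  have h0 := (sq_nonneg (p.coeff (m + 1))).trans_lt hc
  nlinarith [mul_lt_mul_of_pos_left hc (by positivity : (0 : ℝ) < m + 1)]

namespace Finset

variable {ι : Type*} [DecidableEq ι]

/-- The `m`-th elementary symmetric polynomial in the variables indexed by `s`. -/
noncomputable def elemSymm (s : Finset ι) (m : ℕ) (x : ι → ℝ) : ℝ :=
  ∑ t ∈ s.powersetCard m, ∏ i ∈ t, x i

omit [DecidableEq ι] in
@[simp] lemma elemSymm_zero (s : Finset ι) (x : ι → ℝ) : s.elemSymm 0 x = 1 := by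
  simp [elemSymm]

omit [DecidableEq ι] in
lemma elemSymm_eq_zero {s : Finset ι} {m : ℕ} (h : #s < m) (x : ι → ℝ) :
    s.elemSymm m x = 0 := by
  rw [elemSymm, powersetCard_eq_empty.2 h, sum_empty]

lemma elemSymm_insert {s : Finset ι} {a : ι} (ha : a ∉ s) (m : ℕ) (x : ι → ℝ) :
    (insert a s).elemSymm (m + 1) x = x a * s.elemSymm m x + s.elemSymm (m + 1) x := by
  unfold elemSymm
  rw [powersetCard_succ_insert ha, sum_union, sum_image, add_comm, mul_sum]
  · congr 1
    refine sum_congr rfl fun t ht => prod_insert fun h => ha ?_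
    exact (mem_powersetCard.1 ht).1 h
  · intro t ht u hu h
    have h1 : a ∉ t := fun h => ha ((mem_powersetCard.1 ht).1 h)
    have h2 : a ∉ u := fun h => ha ((mem_powersetCard.1 hu).1 h)
    rw [← erase_insert h1, ← erase_insert h2]
    exact congrArg (fun v => erase v a) h
  · rw [disjoint_left]
    intro t ht hu
    obtain ⟨u, -, rfl⟩ := mem_image.1 hu
    exact ha ((mem_powersetCard.1 ht).1 (mem_insert_self _ _))

lemma elemSymm_erase {s : Finset ι} {a : ι} (ha : a ∈ s) (m : ℕ) (x : ι → ℝ) :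
    s.elemSymm (m + 1) x =
      x a * (s.erase a).elemSymm m x + (s.erase a).elemSymm (m + 1) x := by
  rw [← elemSymm_insert (notMem_erase a s), insert_erase ha]

omit [DecidableEq ι] in
lemma elemSymm_one (s : Finset ι) (x : ι → ℝ) : s.elemSymm 1 x = ∑ i ∈ s, x i := by
  simp [elemSymm, powersetCard_one]

/-- Euler's identity for elementary symmetric polynomials. -/
lemma succ_mul_elemSymm (s : Finset ι) (m : ℕ) (x : ι → ℝ) :
    (m + 1) * s.elemSymm (m + 1) x = ∑ i ∈ s, x i * (s.erase i).elemSymm m x := by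
  cases m with
  | zero => simp [elemSymm_one]
  | succ m =>
    induction s using Finset.induction generalizing m with
    | empty => rw [elemSymm_eq_zero (by simp), mul_zero, sum_empty]
    | insert a s ha ih =>
      have h : ∀ i ∈ s, x i * ((insert a s).erase i).elemSymm (m + 1) x =
          x a * (x i * (s.erase i).elemSymm m x) + x i * (s.erase i).elemSymm (m + 1) x := by
        intro i hi
        have hne : a ≠ i := fun h => ha (h ▸ hi)
        rw [erase_insert_of_ne hne, elemSymm_insert (fun h => ha (mem_of_mem_erase h))]
        ring
      have h1 : (m + 1) * s.elemSymm (m + 1) x = ∑ i ∈ s, x i * (s.erase i).elemSymm m x := by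
        cases m with
        | zero => simp [elemSymm_one]
        | succ m => exact ih m
      rw [sum_insert ha, erase_insert ha, sum_congr rfl h, sum_add_distrib, ← mul_sum, ← ih m,
        ← h1, elemSymm_insert ha]
      push_cast
      ring

omit [DecidableEq ι] in
/-- A weak form of Newton's inequalities for elementary symmetric polynomials. -/
lemma elemSymm_mul_elemSymm_le_sq (s : Finset ι) (m : ℕ) (x : ι → ℝ) :
    s.elemSymm m x * s.elemSymm (m + 2) x ≤ s.elemSymm (m + 1) x ^ 2 := by
  by_cases hm : m + 2 ≤ #s
  · have hp : (∏ i ∈ s, (Polynomial.X + Polynomial.C (x i))).Splits :=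
      Polynomial.Splits.prod fun i _ => Polynomial.Splits.X_add_C _
    have h := coeff_mul_coeff_le_sq hp (#s - (m + 2))
    rw [Finset.prod_X_add_C_coeff _ _ (by lia), Finset.prod_X_add_C_coeff _ _ (by lia),
      Finset.prod_X_add_C_coeff _ _ (by lia), show #s - (#s - (m + 2)) = m + 2 by lia,
      show #s - (#s - (m + 2) + 1) = m + 1 by lia,
      show #s - (#s - (m + 2) + 2) = m by lia] at h
    rw [mul_comm]
    exact h
  · rw [elemSymm_eq_zero (not_le.1 hm), mul_zero]
    positivity

lemma elemSymm_erase_pos {s : Finset ι} {a : ι} (ha : a ∈ s) {x : ι → ℝ} (k : ℕ)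
    (hx : ∀ j ≤ k + 1, 0 < s.elemSymm j x) : 0 < (s.erase a).elemSymm k x := by
  induction k with
  | zero => simp
  | succ k ih =>
    have h0 := ih fun j hj => hx j (by lia)
    have h1 := hx (k + 1) (by lia)
    have h2 := hx (k + 2) le_rfl
    rw [elemSymm_erase ha] at h1 h2
    have h3 := elemSymm_mul_elemSymm_le_sq (s.erase a) k x
    by_contra! hneg
    nlinarith [mul_pos h0 h2, mul_nonneg (neg_nonneg.2 hneg) h1.le]

lemma succ_mul_elemSymm_div {s : Finset ι} {x : ι → ℝ} {k : ℕ}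
    (hx : 0 < s.elemSymm (k + 1) x) (h0 : ∀ i ∈ s, 0 < (s.erase i).elemSymm k x) :
    (k + 2) * (s.elemSymm (k + 2) x / s.elemSymm (k + 1) x) =
      ∑ i ∈ s, (x i - x i ^ 2 /
        (x i + (s.erase i).elemSymm (k + 1) x / (s.erase i).elemSymm k x)) := by
  have h := succ_mul_elemSymm s (k + 1) x
  push_cast at h
  rw [← mul_div_assoc, show (k + 2 : ℝ) = k + 1 + 1 by ring, h, sum_div]
  refine sum_congr rfl fun i hi => ?_
  have hi0 := h0 i hi
  rw [elemSymm_erase hi] at hx ⊢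
  have : x i + (s.erase i).elemSymm (k + 1) x / (s.erase i).elemSymm k x =
      (x i * (s.erase i).elemSymm k x + (s.erase i).elemSymm (k + 1) x) /
        (s.erase i).elemSymm k x := by
    field_simp
  rw [this]
  field_simp
  ring

/-- The Marcus–Lopes inequality on the Gårding cone: the cone is closed under addition and
quotients of consecutive elementary symmetric polynomials are superadditive on it. -/
lemma elemSymm_add_pos_and_div_superadditive (k : ℕ) (s : Finset ι) {x y : ι → ℝ}
    (hx : ∀ j ≤ k, 0 < s.elemSymm j x) (hy : ∀ j ≤ k, 0 < s.elemSymm j y) :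
    (∀ j ≤ k, 0 < s.elemSymm j (x + y)) ∧
      s.elemSymm (k + 1) x / s.elemSymm k x + s.elemSymm (k + 1) y / s.elemSymm k y ≤
        s.elemSymm (k + 1) (x + y) / s.elemSymm k (x + y) := by
  induction k generalizing s with
  | zero =>
    refine ⟨fun j hj => ?_, ?_⟩
    · simp [Nat.le_zero.1 hj]
    · simp [elemSymm_one, sum_add_distrib]
  | succ k ih =>
    obtain ⟨hpos, hq⟩ := ih s (fun j hj => hx j (by lia)) (fun j hj => hy j (by lia))
    have hxk := hx (k + 1) le_rfl
    have hyk := hy (k + 1) le_rfl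
    have hk : 0 < s.elemSymm (k + 1) (x + y) := by
      have h1 := div_pos hxk (hx k (by lia))
      have h2 := div_pos hyk (hy k (by lia))
      exact (div_pos_iff_of_pos_right (hpos k le_rfl)).1 (by linarith)
    have hpos' : ∀ j ≤ k + 1, 0 < s.elemSymm j (x + y) := by
      intro j hj
      rcases Nat.le_succ_iff.1 hj with h | rfl
      · exact hpos j h
      · exact hk
    refine ⟨hpos', ?_⟩
    have erase_pos : ∀ {z : ι → ℝ}, (∀ j ≤ k + 1, 0 < s.elemSymm j z) →
        ∀ i ∈ s, ∀ j ≤ k, 0 < (s.erase i).elemSymm j z := fun hz i hi j hj =>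
      elemSymm_erase_pos hi j fun l hl => hz l (by lia)
    have add_div_pos : ∀ {z : ι → ℝ}, (∀ j ≤ k + 1, 0 < s.elemSymm j z) → ∀ i ∈ s,
        0 < z i + (s.erase i).elemSymm (k + 1) z / (s.erase i).elemSymm k z := by
      intro z hz i hi
      have h0 := erase_pos hz i hi k le_rfl
      have h1 := hz (k + 1) le_rfl
      rw [elemSymm_erase hi] at h1
      have := div_pos h1 h0
      rwa [add_div, mul_div_cancel_right₀ _ h0.ne'] at this
    have hk2 : (0 : ℝ) < k + 2 := by positivity
    apply le_of_mul_le_mul_left _ hk2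
    rw [mul_add, succ_mul_elemSymm_div hxk fun i hi => erase_pos hx i hi k le_rfl,
      succ_mul_elemSymm_div hyk fun i hi => erase_pos hy i hi k le_rfl,
      succ_mul_elemSymm_div hk fun i hi => erase_pos hpos' i hi k le_rfl, ← sum_add_distrib]
    refine sum_le_sum fun i hi => ?_
    have hqi := (ih (s.erase i) (erase_pos hx i hi) (erase_pos hy i hi)).2
    have hxi := add_div_pos hx i hi
    have hyi := add_div_pos hy i hi
    have hsq := add_sq_div_add_le (x i) (y i) hxi hyi
    have hmono := div_le_div_of_nonneg_left (sq_nonneg (x i + y i)) (add_pos hxi hyi)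
      (show _ ≤ (x + y) i + (s.erase i).elemSymm (k + 1) (x + y) /
        (s.erase i).elemSymm k (x + y) by rw [Pi.add_apply]; linarith)
    rw [Pi.add_apply] at hmono ⊢
    linarith

end Finset

lemma mem_GardingCone_iff {n k : ℕ} {x : Fin n → ℝ} :
    x ∈ GardingCone n k ↔ ∀ j ≤ k, 0 < Finset.univ.elemSymm j x := by
  refine ⟨fun h j hj => ?_, fun h j _ hj => h j hj⟩
  rcases Nat.eq_zero_or_pos j with rfl | h0
  · simp
  · exact h j h0 hj

lemma esymm_smul (n m : ℕ) (c : ℝ) (x : Fin n → ℝ) :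
    esymm n m (c • x) = c ^ m * esymm n m x := by
  unfold esymm
  rw [Finset.mul_sum]
  refine Finset.sum_congr rfl fun t ht => ?_
  simp [Finset.prod_mul_distrib, (Finset.mem_powersetCard.1 ht).2]

lemma continuous_esymm (n m : ℕ) : Continuous (esymm n m) := by
  unfold esymm
  fun_prop

lemma smul_mem_GardingCone {n k : ℕ} {c : ℝ} (hc : 0 < c) {x : Fin n → ℝ}
    (hx : x ∈ GardingCone n k) : c • x ∈ GardingCone n k := by
  intro j h1 hj
  rw [esymm_smul]
  exact mul_pos (pow_pos hc j) (hx j h1 hj)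

lemma isOpen_GardingCone (n k : ℕ) : IsOpen (GardingCone n k) := by
  have h : GardingCone n k = ⋂ j ∈ Finset.Icc 1 k, {x | 0 < esymm n j x} := by
    ext x
    simp [GardingCone]
  rw [h]
  exact isOpen_biInter_finset fun j _ => isOpen_lt continuous_const (continuous_esymm n j)

lemma add_mem_GardingCone {n k : ℕ} {x y : Fin n → ℝ} (hx : x ∈ GardingCone n k)
    (hy : y ∈ GardingCone n k) : x + y ∈ GardingCone n k :=
  mem_GardingCone_iff.2 (Finset.elemSymm_add_pos_and_div_superadditive k _
    (mem_GardingCone_iff.1 hx) (mem_GardingCone_iff.1 hy)).1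

/-- for `1 ≤ k ≤ n`, the Gårding cone `Γ_k` is an open convex cone in
`ℝⁿ` (open, convex, closed under multiplication by positive scalars) containing the
positive orthant. -/
theorem stmt17 (n k : ℕ) (hk : 1 ≤ k) (hkn : k ≤ n) :
    IsOpen (GardingCone n k) ∧
    Convex ℝ (GardingCone n k) ∧
    (∀ c : ℝ, 0 < c → ∀ lam ∈ GardingCone n k, c • lam ∈ GardingCone n k) ∧
    {lam : Fin n → ℝ | ∀ i, 0 < lam i} ⊆ GardingCone n k := by
  refine ⟨isOpen_GardingCone n k, ?_, fun c hc x hx => smul_mem_GardingCone hc hx, ?_⟩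
  · rw [convex_iff_forall_pos]
    exact fun x hx y hy a b ha hb _ =>
      add_mem_GardingCone (smul_mem_GardingCone ha hx) (smul_mem_GardingCone hb hy)
  · intro x hx j _ hj
    refine Finset.sum_pos (fun t _ => Finset.prod_pos fun i _ => hx i) ?_
    exact Finset.powersetCard_nonempty.2 (by simpa using hj.trans hkn)
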